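/- arXiv:0705.4270 — 3 statements merged into one kernel-verified Lean document; each statement's English description precedes it below -/
import Mathlib

section
/- Let P be a partially ordered set, let ℱ be a filter on P that order-converges to x ∈ P, and let a, b ∈ P. If x ≰ a, then P \ (a] ∈ ℱ, where (a] = {y ∈ P : y ≤ a}. Dually, if x ≱ b, then P \ [b) ∈ ℱ, where [b) = {y ∈ P : y ≥ b}. -/
open Filter Set

/-- The set of upper bounds of a filter: `ℱ^u = ⋃ {S^u : S ∈ ℱ}`. -/
def Filter.ubs {P : Type*} [PartialOrder P] (F : Filter P) : Set P :=
  {z | ∃ S ∈ F, z ∈ upperBounds S}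

/-- The set of lower bounds of a filter: `ℱ^l = ⋃ {S^l : S ∈ ℱ}`. -/
def Filter.lbs {P : Type*} [PartialOrder P] (F : Filter P) : Set P :=
  {z | ∃ S ∈ F, z ∈ lowerBounds S}

/-- A filter `ℱ` order-converges to `x` if `x = ⋀ ℱ^u = ⋁ ℱ^l`. -/
def OrderConverges {P : Type*} [PartialOrder P] (F : Filter P) (x : P) : Prop :=
  IsGLB F.ubs x ∧ IsLUB F.lbs x

/-- if `ℱ →̇ x` then `x ≰ a` implies `P \ (a] ∈ ℱ`, and
`x ≱ b` implies `P \ [b) ∈ ℱ`. -/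
theorem compl_principal_mem_of_orderConverges {P : Type*} [PartialOrder P]
    (F : Filter P) [F.NeBot] (x a b : P) (h : OrderConverges F x) :
    (¬ x ≤ a → {y : P | y ≤ a}ᶜ ∈ F) ∧ (¬ b ≤ x → {y : P | b ≤ y}ᶜ ∈ F) := by
  refine ⟨fun hxa => ?_, fun hbx => ?_⟩
  · obtain ⟨l, ⟨S, hS, hl⟩, hla⟩ : ∃ l ∈ F.lbs, ¬ l ≤ a := by
      by_contra! hle
      exact hxa (h.2.2 hle)
    exact mem_of_superset hS fun y hy hya => hla ((hl hy).trans hya)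
  · obtain ⟨u, ⟨S, hS, hu⟩, hbu⟩ : ∃ u ∈ F.ubs, ¬ b ≤ u := by
      by_contra! hle
      exact hbx (h.1.2 hle)
    exact mem_of_superset hS fun y hy hby => hbu (le_trans hby (hu hy))
end

section
/- Let (P, ≤) be a partially ordered set and let τ be a topology on P such that (P, τ) is compact and τ contains the interval topology τ_i(P). Then τ is contained in the order convergence topology τ_o(P), i.e., every τ-open set is τ_o(P)-open. -/
open Filter Set

/-- The order convergence topology `τ_o(P)`: `U` is open iff every filter
order-converging to a point of `U` contains `U`. -/
def orderConvTopology (P : Type*) [PartialOrder P] : TopologicalSpace P where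
  IsOpen U := ∀ x ∈ U, ∀ F : Filter P, F.NeBot → OrderConverges F x → U ∈ F
  isOpen_univ := fun _ _ _ _ _ => Filter.univ_mem
  isOpen_inter := fun U V hU hV x hx F hne hc =>
    Filter.inter_mem (hU x hx.1 F hne hc) (hV x hx.2 F hne hc)
  isOpen_sUnion := fun S hS x hx F hne hc => by
    obtain ⟨U, hU, hxU⟩ := hx
    exact Filter.mem_of_superset (hS U hU x hxU F hne hc) (Set.subset_sUnion_of_mem hU)

/-- The interval topology `τ_i(P)`, generated by the complements of principal
ideals `(a]` and principal filters `[a)`. -/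
def intervalTopology (P : Type*) [PartialOrder P] : TopologicalSpace P :=
  TopologicalSpace.generateFrom
    ({S | ∃ a : P, S = {y : P | y ≤ a}ᶜ} ∪ {S | ∃ a : P, S = {y : P | a ≤ y}ᶜ})

/-- A cluster point of a filter lies in every closed member of the filter. -/
theorem IsClosed.mem_of_clusterPt_of_mem {X : Type*} [TopologicalSpace X] {C : Set X}
    (hC : IsClosed C) {F : Filter X} {y : X} (hy : ClusterPt y F) (h : C ∈ F) : y ∈ C :=
  isClosed_iff_clusterPt.mp hC y (hy.mono (le_principal_iff.mpr h))

/-- If principal ideals and principal filters are closed, an order limit of a filter is its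
only cluster point. -/
theorem OrderConverges.eq_of_clusterPt {P : Type*} [PartialOrder P] [TopologicalSpace P]
    (hIic : ∀ a : P, IsClosed (Iic a)) (hIci : ∀ a : P, IsClosed (Ici a))
    {F : Filter P} {x y : P} (hx : OrderConverges F x) (hy : ClusterPt y F) : y = x := by
  apply le_antisymm
  · refine hx.1.2 ?_
    rintro z ⟨S, hS, hz⟩
    exact (hIic z).mem_of_clusterPt_of_mem hy (mem_of_superset hS fun s hs => hz hs)
  · refine hx.2.2 ?_
    rintro z ⟨S, hS, hz⟩
    exact (hIci z).mem_of_clusterPt_of_mem hy (mem_of_superset hS fun s hs => hz hs)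

/-- if `τ` is a compact topology on a poset `P` containing the
interval topology, then `τ` is contained in the order convergence topology. -/
theorem compact_topology_le_orderConvTopology {P : Type*} [PartialOrder P]
    (τ : TopologicalSpace P) (hcomp : @CompactSpace P τ)
    (hfine : ∀ U : Set P, (intervalTopology P).IsOpen U → τ.IsOpen U) :
    ∀ U : Set P, τ.IsOpen U → (orderConvTopology P).IsOpen U := by
  intro U hU x hxU F _ hFx
  have hIic (a : P) : IsClosed (Iic a) :=
    ⟨hfine _ (TopologicalSpace.GenerateOpen.basic _ (Or.inl ⟨a, rfl⟩))⟩
  have hIci (a : P) : IsClosed (Ici a) :=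
    ⟨hfine _ (TopologicalSpace.GenerateOpen.basic _ (Or.inr ⟨a, rfl⟩))⟩
  by_contra hUF
  have hne : (F ⊓ 𝓟 Uᶜ).NeBot := ⟨fun h => hUF (mem_iff_inf_principal_compl.mpr h)⟩
  obtain ⟨y, hy⟩ := exists_clusterPt_of_compactSpace (F ⊓ 𝓟 Uᶜ)
  have hyU : y ∈ Uᶜ := IsClosed.mem_of_clusterPt_of_mem
    (isClosed_compl_iff.mpr hU) hy (mem_inf_of_right (mem_principal_self _))
  exact hyU (hFx.eq_of_clusterPt hIic hIci (hy.mono inf_le_left) ▸ hxU)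
end

section
/- Let (P, τ, ≤) be a Priestley space, i.e., a compact ordered topological space that is totally order-disconnected (whenever x ≰ y there exists a clopen up-set containing x but not y). Then τ is contained in the order convergence topology τ_o(P). -/
open Filter Set

/-- if `(P, τ, ≤)` is a Priestley space (compact and totally
order-disconnected), then `τ` is contained in the order convergence topology. -/
theorem priestley_topology_le_orderConvTopology {P : Type*} [PartialOrder P]
    (τ : TopologicalSpace P) (hcomp : @CompactSpace P τ)
    (hpriestley : ∀ x y : P, ¬ x ≤ y →
      ∃ U : Set P, @IsClopen P τ U ∧ IsUpperSet U ∧ x ∈ U ∧ y ∉ U) :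
    ∀ U : Set P, τ.IsOpen U → (orderConvTopology P).IsOpen U := by
  let := τ
  intro U hU x hx F _ hF
  refine mem_iff_ultrafilter.2 fun G hG => ?_
  obtain ⟨y, hy⟩ : ∃ y, (G : Filter P) ≤ nhds y := ⟨_, G.le_nhds_lim⟩
  have hyx : y ≤ x := hF.1.2 fun z ⟨S, hS, hz⟩ => by
    by_contra h
    obtain ⟨V, hV, hup, hyV, hzV⟩ := hpriestley y z h
    obtain ⟨w, hwV, hwS⟩ :=
      G.neBot.nonempty_of_mem (inter_mem (hy (hV.isOpen.mem_nhds hyV)) (hG hS))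
    exact hzV (hup (hz hwS) hwV)
  have hxy : x ≤ y := hF.2.2 fun z ⟨S, hS, hz⟩ => by
    by_contra h
    obtain ⟨V, hV, hup, hzV, hyV⟩ := hpriestley z y h
    obtain ⟨w, hwV, hwS⟩ :=
      G.neBot.nonempty_of_mem (inter_mem (hy (hV.compl.isOpen.mem_nhds hyV)) (hG hS))
    exact hwV (hup (hz hwS) hzV)
  obtain rfl := le_antisymm hyx hxy
  exact hy (IsOpen.mem_nhds hU hx)
end
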